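/- arXiv:2402.07396 — 7 statements merged into one kernel-verified Lean document; each statement's English description precedes it below -/
import Mathlib

section
/- Let v, Δ ∈ ℝ³ with v ≠ 0, v+Δ ≠ 0 and Δ ≠ 0. Then for every real T with 0 < T < π/(2|Δ|), one has h(T) ≥ 0, i.e., cos(T|v|)·cos(T|v+Δ|) + ((v·(v+Δ))/(|v| |v+Δ|))·sin(T|v|)·sin(T|v+Δ|) ≥ cos(T|Δ|). -/
/-- Euclidean norm on ℝ³. -/
noncomputable def enorm3 (a : Fin 3 → ℝ) : ℝ :=
  Real.sqrt (a 0 ^ 2 + a 1 ^ 2 + a 2 ^ 2)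

/-- Dot product on ℝ³. -/
def dot3 (a b : Fin 3 → ℝ) : ℝ := a 0 * b 0 + a 1 * b 1 + a 2 * b 2

theorem Real.mul_abs_sin_le_mul_sin {u y : ℝ} (hu : 0 ≤ u) (hu' : u ≤ Real.pi / 2)
    (huy : u ≤ y) : u * |Real.sin y| ≤ y * Real.sin u := by
  have hpi := Real.pi_pos
  rcases (hu.trans huy).eq_or_lt with rfl | hy
  · simp
  rcases le_total y (Real.pi / 2) with hy' | hy'
  · rw [abs_of_nonneg (Real.sin_nonneg_of_nonneg_of_le_pi hy.le (by linarith))]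
    have h := strictConcaveOn_sin_Icc.concaveOn.2
      (show (0 : ℝ) ∈ Set.Icc 0 Real.pi from ⟨le_rfl, hpi.le⟩)
      (show y ∈ Set.Icc 0 Real.pi from ⟨hy.le, by linarith⟩)
      (show 0 ≤ 1 - u / y by rw [sub_nonneg, div_le_one hy]; exact huy)
      (show 0 ≤ u / y by positivity) (by ring)
    simp only [smul_eq_mul, mul_zero, Real.sin_zero, zero_add, div_mul_cancel₀ u hy.ne'] at h
    rw [div_mul_eq_mul_div, div_le_iff₀ hy] at h
    linarith
  · have hs := Real.mul_le_sin hu hu'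
    rw [div_mul_eq_mul_div, div_le_iff₀ hpi] at hs
    have hsin : 0 ≤ Real.sin u := Real.sin_nonneg_of_nonneg_of_le_pi hu (by linarith)
    calc u * |Real.sin y| ≤ u * 1 := by gcongr; exact Real.abs_sin_le_one y
      _ ≤ Real.pi / 2 * Real.sin u := by linarith
      _ ≤ y * Real.sin u := by gcongr

/-- If `d` is the third side of a Euclidean triangle with sides `a`, `b` and angle cosine `c`, then
the third side of the spherical triangle with the same data is at most `d`. -/
theorem Real.cos_le_cos_mul_cos_add_mul_sin_mul_sin {a b c d : ℝ} (ha : 0 < a) (hb : 0 < b)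
    (hd : 0 ≤ d) (hd' : d ≤ Real.pi / 2) (hc : |c| ≤ 1)
    (h : d ^ 2 = a ^ 2 + b ^ 2 - 2 * a * b * c) :
    Real.cos d ≤ Real.cos a * Real.cos b + c * (Real.sin a * Real.sin b) := by
  obtain ⟨hc₁, hc₂⟩ := abs_le.1 hc
  have hab : 0 < a * b := mul_pos ha hb
  have hsum : d ≤ a + b := by
    apply le_of_sq_le_sq _ (by positivity)
    nlinarith
  obtain ⟨hp₁, hp₂⟩ : -d ≤ a - b ∧ a - b ≤ d := by
    apply abs_le.1
    apply abs_le_of_sq_le_sq _ hd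
    nlinarith
  set u := (d + (a - b)) / 2 with hu
  set w := (d - (a - b)) / 2 with hw
  have hu0 : 0 ≤ u := by linarith
  have hw0 : 0 ≤ w := by linarith
  have hsu := Real.mul_abs_sin_le_mul_sin hu0 (by linarith) (show u ≤ a by linarith)
  have hsw := Real.mul_abs_sin_le_mul_sin hw0 (by linarith) (show w ≤ b by linarith)
  have huw : u * w = a * b * (1 - c) / 2 := by
    rw [hu, hw]; linarith
  have key : a * b * ((1 - c) * (Real.sin a * Real.sin b)) ≤
      a * b * (2 * (Real.sin u * Real.sin w)) := by
    have hmul := mul_le_mul hsu hsw (by positivity) ((by positivity : 0 ≤ u * |Real.sin a|).trans hsu)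
    have habs : u * w * (Real.sin a * Real.sin b) ≤ u * w * |Real.sin a * Real.sin b| := by
      gcongr
      exact le_abs_self _
    rw [abs_mul] at habs
    rw [huw] at habs
    have : u * |Real.sin a| * (w * |Real.sin b|) =
        a * b * (1 - c) / 2 * (|Real.sin a| * |Real.sin b|) := by rw [← huw]; ring
    linarith
  have key' := le_of_mul_le_mul_left key hab
  have hcos : Real.cos (a - b) - Real.cos d = 2 * (Real.sin u * Real.sin w) := by
    have h₁ : a - b = u - w := by rw [hu, hw]; ring
    have h₂ : d = u + w := by rw [hu, hw]; ring
    rw [h₁, h₂, Real.cos_sub, Real.cos_add]; ring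
  rw [Real.cos_sub] at hcos
  linarith

theorem enorm3_sq (a : Fin 3 → ℝ) : enorm3 a ^ 2 = a 0 ^ 2 + a 1 ^ 2 + a 2 ^ 2 :=
  Real.sq_sqrt (by positivity)

theorem enorm3_nonneg (a : Fin 3 → ℝ) : 0 ≤ enorm3 a := Real.sqrt_nonneg _

theorem enorm3_pos {a : Fin 3 → ℝ} (ha : a ≠ 0) : 0 < enorm3 a := by
  refine (enorm3_nonneg a).lt_of_ne fun h => ha ?_
  have hs := enorm3_sq a
  rw [← h] at hs
  ext i
  fin_cases i <;> simp <;> nlinarith [sq_nonneg (a 0), sq_nonneg (a 1), sq_nonneg (a 2)]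

theorem abs_dot3_le (a b : Fin 3 → ℝ) : |dot3 a b| ≤ enorm3 a * enorm3 b := by
  apply abs_le_of_sq_le_sq _ (mul_nonneg (enorm3_nonneg a) (enorm3_nonneg b))
  rw [mul_pow, enorm3_sq, enorm3_sq, dot3]
  nlinarith [sq_nonneg (a 0 * b 1 - a 1 * b 0), sq_nonneg (a 0 * b 2 - a 2 * b 0),
    sq_nonneg (a 1 * b 2 - a 2 * b 1)]

theorem enorm3_sq_eq_add_sub_dot3 (v Δ : Fin 3 → ℝ) :
    enorm3 Δ ^ 2 = enorm3 v ^ 2 + enorm3 (v + Δ) ^ 2 - 2 * dot3 v (v + Δ) := by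
  simp only [enorm3_sq, dot3, Pi.add_apply]
  ring

theorem stmt2 (v Δ : Fin 3 → ℝ) (hv : v ≠ 0) (hvΔ : v + Δ ≠ 0) (hΔ : Δ ≠ 0)
    (T : ℝ) (hT0 : 0 < T) (hT : T < Real.pi / (2 * enorm3 Δ)) :
    Real.cos (T * enorm3 v) * Real.cos (T * enorm3 (v + Δ)) +
        dot3 v (v + Δ) / (enorm3 v * enorm3 (v + Δ)) *
          (Real.sin (T * enorm3 v) * Real.sin (T * enorm3 (v + Δ))) ≥
      Real.cos (T * enorm3 Δ) := by
  have hn := enorm3_pos hv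
  have hn' := enorm3_pos hvΔ
  have hm := enorm3_pos hΔ
  apply Real.cos_le_cos_mul_cos_add_mul_sin_mul_sin (mul_pos hT0 hn) (mul_pos hT0 hn')
    (mul_pos hT0 hm).le
  · rw [lt_div_iff₀ (by positivity)] at hT
    linarith
  · rw [abs_div, abs_of_pos (mul_pos hn hn'), div_le_one (mul_pos hn hn')]
    exact abs_dot3_le v (v + Δ)
  · rw [mul_pow, enorm3_sq_eq_add_sub_dot3]
    field_simp
end

section
/- Let v, Δ ∈ ℝ³ with v×Δ ≠ 0 (so in particular v ≠ 0, v+Δ ≠ 0, Δ ≠ 0), and set ε₆ := ((1/2)|Δ|² + |v|² + |v+Δ|²)/15. Then for every real T with 0 < T ≤ π/(|v| + |v+Δ|), one has h(T) > (T⁴/6)·|v×Δ|²·(1 − ε₆ T²) and this lower bound is strictly positive, so h(T) > 0. -/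
/-- Cross product on ℝ³. -/
def cross3 (a b : Fin 3 → ℝ) : Fin 3 → ℝ :=
  ![a 1 * b 2 - a 2 * b 1, a 2 * b 0 - a 0 * b 2, a 0 * b 1 - a 1 * b 0]

/-- The function h from the paper. -/
noncomputable def hFun (v Δ : Fin 3 → ℝ) (T : ℝ) : ℝ :=
  Real.cos (T * enorm3 v) * Real.cos (T * enorm3 (v + Δ)) +
    dot3 v (v + Δ) / (enorm3 v * enorm3 (v + Δ)) *
      (Real.sin (T * enorm3 v) * Real.sin (T * enorm3 (v + Δ))) -
    Real.cos (T * enorm3 Δ)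

/-- The cubic Taylor lower bound for the sine. -/
lemma sub_cube_div_six_lt_sin {t : ℝ} (ht : 0 < t) : t - t ^ 3 / 6 < Real.sin t := by
  have hmono : StrictMonoOn (fun t : ℝ => Real.sin t - (t - t ^ 3 / 6)) (Set.Ici 0) := by
    refine strictMonoOn_of_hasDerivWithinAt_pos (f' := fun t => Real.cos t - (1 - t ^ 2 / 2))
      (convex_Ici 0) (by fun_prop) (fun y _ => ?_) (fun y hy => ?_)
    · refine HasDerivAt.hasDerivWithinAt ?_
      refine ((Real.hasDerivAt_sin y).sub
        ((hasDerivAt_id' y).sub (((hasDerivAt_id' y).pow 3).div_const 6))).congr_deriv ?_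
      norm_num
      ring
    · rw [interior_Ici, Set.mem_Ioi] at hy
      have := Real.one_sub_sq_div_two_lt_cos hy.ne'
      linarith
  have := hmono Set.self_mem_Ici ht.le ht
  simp at this
  linarith

/-- The numerator of the derivative of `1 - t ^ 2 / 6 + t ^ 4 / 120 - sin t / t` is positive. -/
lemma sin_sub_mul_cos_sub_pos {t : ℝ} (ht : 0 < t) :
    0 < Real.sin t - t * Real.cos t - t ^ 3 / 3 + t ^ 5 / 30 := by
  have hmono : StrictMonoOn
      (fun t : ℝ => Real.sin t - t * Real.cos t - t ^ 3 / 3 + t ^ 5 / 30) (Set.Ici 0) := by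
    refine strictMonoOn_of_hasDerivWithinAt_pos
      (f' := fun t => t * (Real.sin t - (t - t ^ 3 / 6)))
      (convex_Ici 0) (by fun_prop) (fun y _ => ?_) (fun y hy => ?_)
    · refine HasDerivAt.hasDerivWithinAt ?_
      refine ((((Real.hasDerivAt_sin y).sub ((hasDerivAt_id' y).mul (Real.hasDerivAt_cos y))).sub
        (((hasDerivAt_id' y).pow 3).div_const 3)).add
        (((hasDerivAt_id' y).pow 5).div_const 30)).congr_deriv ?_
      norm_num
      ring
    · rw [interior_Ici, Set.mem_Ioi] at hy
      exact mul_pos hy (sub_pos.2 (sub_cube_div_six_lt_sin hy))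
  have := hmono Set.self_mem_Ici ht.le ht
  simpa using this

lemma strictMonoOn_taylor_sub_sinc :
    StrictMonoOn (fun t : ℝ => 1 - t ^ 2 / 6 + t ^ 4 / 120 - Real.sin t / t) (Set.Ioi 0) := by
  refine strictMonoOn_of_hasDerivWithinAt_pos
    (f' := fun t => (Real.sin t - t * Real.cos t - t ^ 3 / 3 + t ^ 5 / 30) / t ^ 2)
    (convex_Ioi 0) ?_ (fun y hy => ?_) (fun y hy => ?_)
  · refine ContinuousOn.sub (by fun_prop) (ContinuousOn.div (by fun_prop) (by fun_prop) ?_)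
    exact fun y hy => (Set.mem_Ioi.1 hy).ne'
  · rw [interior_Ioi, Set.mem_Ioi] at hy
    have hy' := hy.ne'
    refine HasDerivAt.hasDerivWithinAt ?_
    refine (((((hasDerivAt_id' y).pow 2).div_const 6).const_sub 1).add
      (((hasDerivAt_id' y).pow 4).div_const 120) |>.sub
      ((Real.hasDerivAt_sin y).div (hasDerivAt_id' y) hy')).congr_deriv ?_
    norm_num
    field_simp
    ring
  · rw [interior_Ioi, Set.mem_Ioi] at hy
    exact div_pos (sin_sub_mul_cos_sub_pos hy) (by positivity)

/-- The remainder of the cubic Taylor polynomial of `s ↦ cos √s` is strictly convex. -/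
lemma strictConvexOn_cos_sqrt_sub_taylor :
    StrictConvexOn ℝ (Set.Ici 0)
      (fun s : ℝ => Real.cos (√s) - (1 - s / 2 + s ^ 2 / 24 - s ^ 3 / 720)) := by
  have hderiv : ∀ s ∈ Set.Ioi (0 : ℝ),
      deriv (fun s : ℝ => Real.cos (√s) - (1 - s / 2 + s ^ 2 / 24 - s ^ 3 / 720)) s =
        (1 - √s ^ 2 / 6 + √s ^ 4 / 120 - Real.sin (√s) / √s) / 2 := by
    intro s hs
    rw [Set.mem_Ioi] at hs
    have hroot : 0 < √s := Real.sqrt_pos.2 hs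
    have hsq : √s ^ 2 = s := Real.sq_sqrt hs.le
    refine HasDerivAt.deriv ?_
    refine ((Real.hasDerivAt_sqrt hs.ne').cos.sub
      (((((hasDerivAt_id' s).div_const 2).const_sub 1).add
        (((hasDerivAt_id' s).pow 2).div_const 24)).sub
        (((hasDerivAt_id' s).pow 3).div_const 720))).congr_deriv ?_
    rw [show √s ^ 4 = (√s ^ 2) ^ 2 by ring, hsq]
    norm_num
    field_simp
    ring
  refine StrictMonoOn.strictConvexOn_of_deriv (convex_Ici 0) (by fun_prop) ?_
  rw [interior_Ici]
  intro s hs t ht hst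
  rw [hderiv s hs, hderiv t ht]
  have := strictMonoOn_taylor_sub_sinc (Set.mem_Ioi.2 (Real.sqrt_pos.2 hs))
    (Set.mem_Ioi.2 (Real.sqrt_pos.2 ht)) (Real.sqrt_lt_sqrt (Set.mem_Ioi.1 hs).le hst)
  simp only at this
  linarith

/-- The lower bound for a Euclidean triangle with sides `a`, `b`, `c`, where `x` is the cosine of
the angle opposite to `c`. -/
lemma triangle_cos_defect_lower_bound {a b c x : ℝ} (ha : 0 < a) (hb : 0 < b)
    (hx : x ^ 2 < 1) (h : c ^ 2 = a ^ 2 + b ^ 2 - 2 * a * b * x) :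
    a ^ 2 * b ^ 2 * (1 - x ^ 2) / 6 * (1 - (c ^ 2 / 2 + a ^ 2 + b ^ 2) / 15) <
      Real.cos a * Real.cos b + x * (Real.sin a * Real.sin b) - Real.cos c := by
  obtain ⟨hx₁, hx₂⟩ := abs_lt.1 ((sq_lt_one_iff_abs_lt_one x).1 hx)
  have hab : 0 < a * b := mul_pos ha hb
  have hne : (a - b) ^ 2 ≠ (a + b) ^ 2 := by nlinarith
  have hconv := strictConvexOn_cos_sqrt_sub_taylor.2 (Set.mem_Ici.2 (sq_nonneg (a - b)))
    (Set.mem_Ici.2 (sq_nonneg (a + b))) hne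
    (show 0 < (1 + x) / 2 by linarith) (show 0 < (1 - x) / 2 by linarith) (by ring)
  have hmid : ((1 + x) / 2) • (a - b) ^ 2 + ((1 - x) / 2) • (a + b) ^ 2 = c ^ 2 := by
    rw [h, smul_eq_mul, smul_eq_mul]
    ring
  rw [hmid] at hconv
  simp only [smul_eq_mul, Real.sqrt_sq_eq_abs, Real.cos_abs, Real.cos_sub,
    Real.cos_add] at hconv
  rw [h] at hconv ⊢
  linarith

theorem stmt3 (v Δ : Fin 3 → ℝ) (hcross : cross3 v Δ ≠ 0) (ε₆ : ℝ)
    (hε₆ : ε₆ = ((1 / 2) * enorm3 Δ ^ 2 + enorm3 v ^ 2 + enorm3 (v + Δ) ^ 2) / 15)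
    (T : ℝ) (hT0 : 0 < T) (hT : T ≤ Real.pi / (enorm3 v + enorm3 (v + Δ))) :
    hFun v Δ T > T ^ 4 / 6 * enorm3 (cross3 v Δ) ^ 2 * (1 - ε₆ * T ^ 2) ∧
      0 < T ^ 4 / 6 * enorm3 (cross3 v Δ) ^ 2 * (1 - ε₆ * T ^ 2) := by
  have hsq (a : Fin 3 → ℝ) : enorm3 a ^ 2 = a 0 ^ 2 + a 1 ^ 2 + a 2 ^ 2 :=
    Real.sq_sqrt (by positivity)
  have hnonneg (a : Fin 3 → ℝ) : 0 ≤ enorm3 a := Real.sqrt_nonneg _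
  have hlagrange : enorm3 (cross3 v Δ) ^ 2 =
      enorm3 v ^ 2 * enorm3 (v + Δ) ^ 2 - dot3 v (v + Δ) ^ 2 := by
    simp only [hsq, cross3, dot3, Pi.add_apply, Matrix.cons_val]
    ring
  have hcosines : enorm3 Δ ^ 2 =
      enorm3 v ^ 2 + enorm3 (v + Δ) ^ 2 - 2 * dot3 v (v + Δ) := by
    simp only [hsq, dot3, Pi.add_apply]
    ring
  have hcross_pos : 0 < enorm3 (cross3 v Δ) ^ 2 := by
    refine lt_of_le_of_ne (sq_nonneg _) fun h0 => hcross ?_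
    rw [hsq] at h0
    ext i
    fin_cases i <;> simp only [Pi.zero_apply] <;> refine pow_eq_zero_iff two_ne_zero |>.1 ?_ <;>
      simp only [Fin.zero_eta, Fin.mk_one, Fin.reduceFinMk] <;>
      nlinarith [sq_nonneg (cross3 v Δ 0), sq_nonneg (cross3 v Δ 1), sq_nonneg (cross3 v Δ 2)]
  unfold hFun
  have hA := hnonneg v
  have hB := hnonneg (v + Δ)
  generalize enorm3 (cross3 v Δ) = N at *
  generalize enorm3 v = A at *
  generalize enorm3 (v + Δ) = B at *
  generalize enorm3 Δ = D at *
  generalize dot3 v (v + Δ) = d at *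
  have hA : 0 < A := by
    refine lt_of_le_of_ne hA ?_
    rintro rfl
    nlinarith [sq_nonneg d]
  have hB : 0 < B := by
    refine lt_of_le_of_ne hB ?_
    rintro rfl
    nlinarith [sq_nonneg d]
  have hAB : 0 < A * B := mul_pos hA hB
  constructor
  · have hx : (d / (A * B)) ^ 2 < 1 := by
      rw [div_pow, div_lt_one (by positivity), mul_pow]
      linarith
    have key := triangle_cos_defect_lower_bound (c := T * D) (mul_pos hT0 hA) (mul_pos hT0 hB)
      hx (by
        rw [mul_pow, hcosines]
        field_simp)
    refine lt_of_eq_of_lt ?_ key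
    rw [hlagrange, hε₆]
    field_simp
  · have hd : -d ≤ A * B := (abs_le_of_sq_le_sq' (by nlinarith) hAB.le).1 |> neg_le.1
    rw [le_div_iff₀ (by positivity)] at hT
    have hπ : (T * (A + B)) ^ 2 < 10 := by
      have := Real.pi_lt_d2
      have : 0 < T * (A + B) := by positivity
      nlinarith
    have hε : ε₆ * T ^ 2 ≤ (T * (A + B)) ^ 2 / 10 := by
      have : ε₆ ≤ (A + B) ^ 2 / 10 := by
        rw [hε₆, hcosines]
        nlinarith
      calc ε₆ * T ^ 2 ≤ (A + B) ^ 2 / 10 * T ^ 2 := by gcongr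
        _ = _ := by ring
    have : 0 < 1 - ε₆ * T ^ 2 := by linarith
    positivity
end

section
/- Let v, Δ ∈ ℝ³ with v ≠ 0 and w := v+Δ ≠ 0. Set a₁ := (|v||w| + v·w)/(2|v||w|), a₂ := (|v||w| − v·w)/(2|v||w|), f₁ := |w| − |v|, f₂ := |w| + |v|. Then a₁ + a₂ = 1, a₁f₁² + a₂f₂² = |Δ|², and a₁f₁⁴ + a₂f₂⁴ − |Δ|⁴ = 4·|v×Δ|². -/
theorem enorm3_ne_zero {a : Fin 3 → ℝ} (ha : a ≠ 0) : enorm3 a ≠ 0 := by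
  intro h
  have hs := enorm3_sq a
  rw [h] at hs
  apply ha
  ext i
  fin_cases i <;> simp <;> nlinarith [sq_nonneg (a 0), sq_nonneg (a 1), sq_nonneg (a 2)]

theorem enorm3_sq_eq_of_add {v Δ w : Fin 3 → ℝ} (hw : w = v + Δ) :
    enorm3 Δ ^ 2 = enorm3 v ^ 2 + enorm3 w ^ 2 - 2 * dot3 v w := by
  subst hw
  simp only [enorm3_sq, dot3, Pi.add_apply]
  ring

theorem enorm3_cross3_sq_eq_of_add {v Δ w : Fin 3 → ℝ} (hw : w = v + Δ) :
    enorm3 (cross3 v Δ) ^ 2 = enorm3 v ^ 2 * enorm3 w ^ 2 - dot3 v w ^ 2 := by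
  subst hw
  simp only [enorm3_sq, dot3, cross3, Pi.add_apply, Matrix.cons_val]
  ring

theorem stmt6 (v Δ w : Fin 3 → ℝ) (hw : w = v + Δ) (hv : v ≠ 0) (hw0 : w ≠ 0)
    (a₁ a₂ f₁ f₂ : ℝ)
    (ha₁ : a₁ = (enorm3 v * enorm3 w + dot3 v w) / (2 * (enorm3 v * enorm3 w)))
    (ha₂ : a₂ = (enorm3 v * enorm3 w - dot3 v w) / (2 * (enorm3 v * enorm3 w)))
    (hf₁ : f₁ = enorm3 w - enorm3 v) (hf₂ : f₂ = enorm3 w + enorm3 v) :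
    a₁ + a₂ = 1 ∧ a₁ * f₁ ^ 2 + a₂ * f₂ ^ 2 = enorm3 Δ ^ 2 ∧
      a₁ * f₁ ^ 4 + a₂ * f₂ ^ 4 - enorm3 Δ ^ 4 = 4 * enorm3 (cross3 v Δ) ^ 2 := by
  have hp := enorm3_ne_zero hv
  have hq := enorm3_ne_zero hw0
  have hΔ := enorm3_sq_eq_of_add hw
  have hΔ4 : enorm3 Δ ^ 4 = (enorm3 v ^ 2 + enorm3 w ^ 2 - 2 * dot3 v w) ^ 2 := by
    rw [← hΔ]
    ring
  rw [hΔ4, hΔ, enorm3_cross3_sq_eq_of_add hw, ha₁, ha₂, hf₁, hf₂]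
  refine ⟨?_, ?_, ?_⟩ <;> field_simp <;> ring
end

section
/- Let f₁, f₂, d be real numbers with 0 ≤ f₁ < d < f₂, and set a₂ := (d² − f₁²)/(f₂² − f₁²) and a₁ := 1 − a₂ (so that a₁f₁² + a₂f₂² = d² and 0 < a₁, a₂ < 1). Then for every even integer n ≥ 6, (a₁f₁ⁿ + a₂f₂ⁿ − dⁿ)·(f₂² + d²) > a₁f₁^{n+2} + a₂f₂^{n+2} − d^{n+2}. -/
/-- The second divided difference of `t ↦ t ^ (k + 2)` at `x < y < z`, cleared of denominators,
is bounded below using the contribution `x ^ k` of the smallest node. -/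
lemma mul_pow_le_divided_difference {x y z : ℝ} (hx : 0 ≤ x) (hxy : x < y) (hyz : y < z) (k : ℕ) :
    (z - y) * (y - x) * (z - x) * x ^ k ≤
      (z - y) * x ^ (k + 2) + (y - x) * z ^ (k + 2) - (z - x) * y ^ (k + 2) := by
  induction k with
  | zero => exact le_of_eq (by ring)
  | succ k ih =>
    have hpow : y ^ (k + 2) ≤ z ^ (k + 2) :=
      pow_le_pow_left₀ (hx.trans hxy.le) hyz.le _
    have hstep : 0 ≤ (y - x) * (z - x) * (z ^ (k + 2) - y ^ (k + 2)) :=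
      mul_nonneg (mul_nonneg (by linarith) (by linarith)) (by linarith)
    have hmul := mul_le_mul_of_nonneg_left ih hx
    linear_combination hmul + hstep

theorem stmt8 (f₁ f₂ d : ℝ) (hf₁ : 0 ≤ f₁) (h1 : f₁ < d) (h2 : d < f₂)
    (a₁ a₂ : ℝ) (ha₂ : a₂ = (d ^ 2 - f₁ ^ 2) / (f₂ ^ 2 - f₁ ^ 2)) (ha₁ : a₁ = 1 - a₂)
    (n : ℕ) (hn : 6 ≤ n) (hne : Even n) :
    (a₁ * f₁ ^ n + a₂ * f₂ ^ n - d ^ n) * (f₂ ^ 2 + d ^ 2) >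
      a₁ * f₁ ^ (n + 2) + a₂ * f₂ ^ (n + 2) - d ^ (n + 2) := by
  obtain ⟨k, rfl⟩ : ∃ k, n = 2 * (k + 3) := by
    obtain ⟨m, rfl⟩ := hne
    exact ⟨m - 3, by omega⟩
  have hx : 0 ≤ f₁ ^ 2 := sq_nonneg _
  have hxy : f₁ ^ 2 < d ^ 2 := by gcongr
  have hyz : d ^ 2 < f₂ ^ 2 := pow_lt_pow_left₀ h2 (by linarith) two_ne_zero
  rw [show 2 * (k + 3) + 2 = 2 * (k + 4) by ring]
  simp only [pow_mul]
  generalize f₁ ^ 2 = x at *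
  generalize d ^ 2 = y at *
  generalize f₂ ^ 2 = z at *
  have hzx : 0 < z - x := by linarith
  have hy : 0 < y := by linarith
  have hz : 0 < z := by linarith
  have ha₂' : a₂ * (z - x) = y - x := by rw [ha₂]; field_simp
  have ha₁' : a₁ * (z - x) = z - y := by rw [ha₁]; linarith
  have hdiff := mul_pow_le_divided_difference hx hxy hyz k
  have hD : 0 < (z - y) * (y - x) * (z - x) :=
    mul_pos (mul_pos (by linarith) (by linarith)) hzx
  have hE : 0 < (z - y) * x ^ (k + 2) + (y - x) * z ^ (k + 2) - (z - x) * y ^ (k + 2) := by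
    rcases hx.eq_or_lt with rfl | hx'
    · have hpow : y ^ (k + 1) < z ^ (k + 1) := pow_lt_pow_left₀ hyz hy.le k.succ_ne_zero
      have hpos : 0 < y * z * (z ^ (k + 1) - y ^ (k + 1)) :=
        mul_pos (mul_pos hy hz) (by linarith)
      rw [zero_pow (by omega)]
      linear_combination hpos
    · exact lt_of_lt_of_le (mul_pos hD (pow_pos hx' k)) hdiff
  have hxx : x ^ 2 < y * z := by nlinarith
  have hkey := mul_le_mul_of_nonneg_left hdiff (sq_nonneg x)
  have hgap := mul_pos (sub_pos.2 hxx) hE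
  rw [gt_iff_lt, ← mul_lt_mul_iff_left₀ hzx]
  have hl : (a₁ * x ^ (k + 4) + a₂ * z ^ (k + 4) - y ^ (k + 4)) * (z - x) =
      (z - y) * x ^ (k + 4) + (y - x) * z ^ (k + 4) - (z - x) * y ^ (k + 4) := by
    linear_combination x ^ (k + 4) * ha₁' + z ^ (k + 4) * ha₂'
  have hr : (a₁ * x ^ (k + 3) + a₂ * z ^ (k + 3) - y ^ (k + 3)) * (z + y) * (z - x) =
      ((z - y) * x ^ (k + 3) + (y - x) * z ^ (k + 3) - (z - x) * y ^ (k + 3)) * (z + y) := by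
    linear_combination (z + y) * (x ^ (k + 3) * ha₁' + z ^ (k + 3) * ha₂')
  rw [hl, hr]
  linear_combination hkey + hgap
end

section
/- Let a₁, f₁, d be real numbers with 0 < a₁ ≤ 1 and 0 ≤ f₁ < d. Then the function T ↦ a₁·cos(f₁T) − cos(dT) is strictly monotonically increasing on the interval [0, π/(2d)]. -/
theorem stmt9 (a₁ f₁ d : ℝ) (ha₁ : 0 < a₁) (ha₁' : a₁ ≤ 1) (hf₁ : 0 ≤ f₁)
    (h1 : f₁ < d) :
    StrictMonoOn (fun T : ℝ => a₁ * Real.cos (f₁ * T) - Real.cos (d * T))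
      (Set.Icc 0 (Real.pi / (2 * d))) := by
  have hd : 0 < d := hf₁.trans_lt h1
  refine strictMonoOn_of_deriv_pos (convex_Icc _ _) (by fun_prop) fun T hT => ?_
  rw [interior_Icc, Set.mem_Ioo, lt_div_iff₀ (by positivity)] at hT
  obtain ⟨hT0, hT1⟩ := hT
  have hderiv : HasDerivAt (fun T : ℝ => a₁ * Real.cos (f₁ * T) - Real.cos (d * T))
      (a₁ * (-Real.sin (f₁ * T) * (f₁ * 1)) - -Real.sin (d * T) * (d * 1)) T :=
    (((hasDerivAt_id T).const_mul f₁).cos.const_mul a₁).sub ((hasDerivAt_id T).const_mul d).cos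
  rw [hderiv.deriv]
  have hfT : 0 ≤ f₁ * T := by positivity
  have hdT : 0 < d * T := by positivity
  have hlt : f₁ * T < d * T := mul_lt_mul_of_pos_right h1 hT0
  have hsin : Real.sin (f₁ * T) ≤ Real.sin (d * T) :=
    Real.sin_le_sin_of_le_of_le_pi_div_two (by linarith [Real.pi_pos]) (by linarith) hlt.le
  have hpos : 0 < Real.sin (d * T) := Real.sin_pos_of_pos_of_lt_pi hdT (by linarith [Real.pi_pos])
  have haf : a₁ * f₁ ≤ f₁ := mul_le_of_le_one_left hf₁ ha₁'
  have hle : a₁ * f₁ * Real.sin (f₁ * T) ≤ f₁ * Real.sin (d * T) :=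
    (mul_le_mul_of_nonneg_left hsin (by positivity)).trans
      (mul_le_mul_of_nonneg_right haf hpos.le)
  linarith [mul_lt_mul_of_pos_right h1 hpos]
end

section
/- For all integers N ≥ L, the no-run probability satisfies the linear recursion F_N = (1 − p) · Σ_{l=1}^{L} p^{l−1} · F_{N−l}. -/
/-- `x`, a sequence of `N` Bernoulli outcomes, contains no run of `L` consecutive
successes: every window of `L` consecutive indices contains a failure. -/
def NoRun (L N : ℕ) (x : Fin N → Bool) : Prop :=
  ∀ i : ℕ, i + L ≤ N → ∃ j : Fin N, i ≤ (j : ℕ) ∧ (j : ℕ) < i + L ∧ x j = false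

open scoped Classical in
/-- The probability that a sequence of `N` independent Bernoulli(`p`) trials
contains no run of `L` consecutive successes. -/
noncomputable def noRunProb (p : ℝ) (L N : ℕ) : ℝ :=
  ∑ x ∈ Finset.univ.filter (fun x : Fin N → Bool => NoRun L N x),
    ∏ i : Fin N, (if x i then p else 1 - p)

/-- The sequence made of `k` successes followed by `x` contains no run of `L` successes. -/
def NoRunAfter (L k N : ℕ) (x : Fin N → Bool) : Prop :=
  ∀ i : ℕ, i + L ≤ N + k →
    ∃ j : Fin N, i ≤ (j : ℕ) + k ∧ (j : ℕ) + k < i + L ∧ x j = false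

theorem not_noRunAfter_self (L N : ℕ) (x : Fin N → Bool) : ¬ NoRunAfter L L N x := by
  intro h
  obtain ⟨j, -, h2, -⟩ := h 0 (by omega)
  omega

theorem noRunAfter_cons_true (L k N : ℕ) (x : Fin N → Bool) :
    NoRunAfter L k (N + 1) (Fin.cons true x : Fin (N + 1) → Bool) ↔
      NoRunAfter L (k + 1) N x := by
  simp only [NoRunAfter, Fin.exists_fin_succ, Fin.cons_zero, Fin.cons_succ, Fin.val_succ,
    Bool.true_eq_false, and_false, false_or, add_assoc, add_comm 1 k]

theorem noRunAfter_cons_false {L k : ℕ} (hk : k < L) (N : ℕ) (x : Fin N → Bool) :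
    NoRunAfter L k (N + 1) (Fin.cons false x : Fin (N + 1) → Bool) ↔ NoRun L N x := by
  simp only [NoRunAfter, NoRun, Fin.exists_fin_succ, Fin.cons_zero, Fin.cons_succ, Fin.val_succ,
    Fin.val_zero, and_true]
  constructor
  · intro h i hi
    obtain h | ⟨j, h1, h2, h3⟩ := h (i + k + 1) (by omega)
    · omega
    · exact ⟨j, by omega, by omega, h3⟩
  · intro h i hi
    by_cases hik : i ≤ k
    · left
      omega
    · obtain ⟨j, h1, h2, h3⟩ := h (i - (k + 1)) (by omega)
      exact Or.inr ⟨j, by omega, by omega, h3⟩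

open scoped Classical in
/-- The probability that `k` successes followed by `N` independent Bernoulli(`p`) trials
contain no run of `L` consecutive successes. -/
noncomputable def noRunAfterProb (p : ℝ) (L k N : ℕ) : ℝ :=
  ∑ x ∈ Finset.univ.filter (fun x : Fin N → Bool => NoRunAfter L k N x),
    ∏ i : Fin N, (if x i then p else 1 - p)

theorem noRunAfterProb_zero (p : ℝ) (L N : ℕ) : noRunAfterProb p L 0 N = noRunProb p L N :=
  rfl

theorem noRunAfterProb_self (p : ℝ) (L N : ℕ) : noRunAfterProb p L L N = 0 := by
  simp [noRunAfterProb, not_noRunAfter_self]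

open scoped Classical in
/-- Conditioning on the outcome of the first trial. -/
theorem noRunAfterProb_succ (p : ℝ) {L k : ℕ} (hk : k < L) (N : ℕ) :
    noRunAfterProb p L k (N + 1) =
      (1 - p) * noRunProb p L N + p * noRunAfterProb p L (k + 1) N := by
  simp only [noRunAfterProb, noRunProb, Finset.sum_filter]
  rw [← (Fin.consEquiv (fun _ : Fin (N + 1) => Bool)).sum_comp, Fintype.sum_prod_type,
    Fintype.sum_bool, add_comm, Finset.mul_sum, Finset.mul_sum]
  simp only [mul_ite, mul_zero]
  congr 1
  · exact Finset.sum_congr rfl fun x _ =>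
      if_congr (noRunAfter_cons_false hk N x) (by simp [Fin.consEquiv, Fin.prod_univ_succ]) rfl
  · exact Finset.sum_congr rfl fun x _ =>
      if_congr (noRunAfter_cons_true L k N x) (by simp [Fin.consEquiv, Fin.prod_univ_succ]) rfl

theorem noRunProb_eq_sum_add (p : ℝ) {L N : ℕ} (hN : L ≤ N) {d : ℕ} (hd : d ≤ L) :
    noRunProb p L N =
      (1 - p) * ∑ l ∈ Finset.range d, p ^ l * noRunProb p L (N - (l + 1)) +
        p ^ d * noRunAfterProb p L d (N - d) := by
  induction d with
  | zero => simp [noRunAfterProb_zero]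
  | succ d ih =>
    rw [ih (by omega), show N - d = N - (d + 1) + 1 by omega, noRunAfterProb_succ p hd,
      Finset.sum_range_succ]
    ring

theorem stmt11 (L : ℕ) (hL : 1 ≤ L) (p : ℝ) (hp0 : 0 ≤ p) (hp1 : p ≤ 1)
    (N : ℕ) (hN : L ≤ N) :
    noRunProb p L N =
      (1 - p) * ∑ l ∈ Finset.Icc 1 L, p ^ (l - 1) * noRunProb p L (N - l) := by
  rw [noRunProb_eq_sum_add p hN le_rfl, noRunAfterProb_self, mul_zero, add_zero,
    ← Finset.Ico_add_one_right_eq_Icc, Finset.sum_Ico_eq_sum_range]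
  simp [add_comm 1]
end

section
/- Let L ≥ 2 be an integer, set c := 2L/(L+1), and define f(z₁) := (c − z₁)^{L+1} − (c − z₁)^L + (1−z₁)·z₁^L for real z₁ (i.e., f(z₁) = g(2L/(L+1) − z₁)). Then f(z₁) > 0 for all z₁ with 0 < z₁ < L/(L+1), f(L/(L+1)) = 0, and f(z₁) < 0 for all z₁ with L/(L+1) < z₁ < 1. -/
theorem one_sub_mul_one_add_pow_lt {L : ℕ} (hL : 2 ≤ L) {v : ℝ} (hv : 0 < v) (hv1 : v < 1) :
    (1 - L * v) * (1 + v) ^ L < (1 + L * v) * (1 - v) ^ L := by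
  have hv3 : 0 < v ^ 3 := by positivity
  induction L, hL using Nat.le_induction with
  | base => push_cast; nlinarith
  | succ n hn ih =>
    have ha : 0 < (1 - v) ^ n := pow_pos (by linarith) n
    have hb : 0 < (1 + v) ^ n := by positivity
    rw [pow_succ, pow_succ]
    push_cast
    generalize (1 - v) ^ n = a at *
    generalize (1 + v) ^ n = b at *
    have hn0 : (0 : ℝ) < n := by exact_mod_cast (by omega : 0 < n)
    generalize (n : ℝ) = x at *
    have hpos : 0 < (1 + (x + 1) * v) * (a * (1 - v)) := by
      have : 0 < 1 - v := by linarith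
      positivity
    rcases le_or_gt (1 - (x + 1) * v) 0 with h | h
    · have : (1 - (x + 1) * v) * (b * (1 + v)) ≤ 0 :=
        mul_nonpos_of_nonpos_of_nonneg h (by positivity)
      linarith
    · have hx : 0 < 1 - x * v := by nlinarith
      refine lt_of_mul_lt_mul_left ?_ hx.le
      calc (1 - x * v) * ((1 - (x + 1) * v) * (b * (1 + v)))
          = (1 - (x + 1) * v) * (1 + v) * ((1 - x * v) * b) := by ring
        _ < (1 - (x + 1) * v) * (1 + v) * ((1 + x * v) * a) :=
            mul_lt_mul_of_pos_left ih (by positivity)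
        _ ≤ (1 - (x + 1) * v) * (1 + v) * ((1 + x * v) * a) + 2 * x * (x + 1) * v ^ 3 * a :=
            le_add_of_nonneg_right (by positivity)
        _ = (1 - x * v) * ((1 + (x + 1) * v) * (a * (1 - v))) := by ring

theorem stmt15 (L : ℕ) (hL : 2 ≤ L) (c : ℝ) (hc : c = 2 * L / (L + 1))
    (f : ℝ → ℝ)
    (hf : ∀ z₁ : ℝ, f z₁ = (c - z₁) ^ (L + 1) - (c - z₁) ^ L + (1 - z₁) * z₁ ^ L) :
    (∀ z₁ : ℝ, 0 < z₁ → z₁ < L / (L + 1) → 0 < f z₁) ∧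
      f (L / (L + 1)) = 0 ∧
      ∀ z₁ : ℝ, L / (L + 1) < z₁ → z₁ < 1 → f z₁ < 0 := by
  have hL0 : (2 : ℝ) ≤ L := by exact_mod_cast hL
  have hm : (0 : ℝ) < L / (L + 1) := by positivity
  have key (v : ℝ) : f (L / (L + 1) * (1 - v)) = 1 / (L + 1) * (L / (L + 1)) ^ L *
      ((1 + L * v) * (1 - v) ^ L - (1 - L * v) * (1 + v) ^ L) := by
    have h1 : c - L / (L + 1) * (1 - v) = L / (L + 1) * (1 + v) := by rw [hc]; ring
    have h2 : 1 - L / (L + 1) * (1 - v) = 1 / (L + 1) * (1 + L * v) := by field_simp; ring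
    have h3 : L / (L + 1) * (1 + v) - 1 = -(1 / (L + 1) * (1 - L * v)) := by field_simp; ring
    rw [hf, h1, h2, pow_succ, ← mul_sub_one, h3, mul_pow, mul_pow]
    ring
  have hC : (0 : ℝ) < 1 / (L + 1) * (L / (L + 1)) ^ L := by positivity
  refine ⟨fun z h0 h1 ↦ ?_, by simpa using key 0, fun z h0 h1 ↦ ?_⟩
  · have hz : z = L / (L + 1) * (1 - (1 - z / (L / (L + 1)))) := by
      rw [sub_sub_cancel, mul_div_cancel₀ _ hm.ne']
    rw [hz, key]
    refine mul_pos hC (sub_pos.2 (one_sub_mul_one_add_pow_lt hL ?_ ?_))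
    · rwa [sub_pos, div_lt_one hm]
    · have := div_pos h0 hm
      linarith
  · have hz : z = L / (L + 1) * (1 - -(z / (L / (L + 1)) - 1)) := by
      rw [neg_sub, sub_sub_cancel, mul_div_cancel₀ _ hm.ne']
    rw [hz, key]
    refine mul_neg_of_pos_of_neg hC ?_
    have := one_sub_mul_one_add_pow_lt (v := z / (L / (L + 1)) - 1) hL
      (by rwa [sub_pos, one_lt_div hm]) (by
        rw [sub_lt_iff_lt_add, div_lt_iff₀ hm]
        refine h1.trans ?_
        rw [← mul_div_assoc, lt_div_iff₀ (by positivity)]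
        linarith)
    rw [mul_neg, sub_neg_eq_add, ← sub_eq_add_neg, ← sub_eq_add_neg]
    linarith
end
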